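/- Let K, L ∈ ℕ with L > K, let α ∈ 𝒞_{K,L} with associated sequence (n_k), and let h(x) = -log x - log(1-x). There exist D, k₀, b₀ > 0 such that for every k ≥ k₀, every b ≥ b₀ and every s ∈ {1, …, q_{n_k}}: (v_s, v_s + D⁻¹e^{−b}/(2q_{n_k})) ∪ (w_s − D⁻¹e^{−b}/(2q_{n_k}), w_s) ⊆ W_{k,s}(b) ⊆ (v_s, v_s + De^{−b}/(2q_{n_k})) ∪ (w_s − De^{−b}/(2q_{n_k}), w_s), where I_s = (v_s, w_s) ranges over the intervals of the partition of 𝕋 by the points {−iα}_{i=0}^{q_{n_k}−1}, y_s is the midpoint of I_s, and W_{k,s}(b) = {x ∈ I_s : |S_{q_{n_k}}(h)(x) − S_{q_{n_k}}(h)(y_s)| ≥ b}. -/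

import Mathlib

open MeasureTheory Filter Topology

noncomputable section

/-- Iterates of the Gauss map applied to the fractional part of `α`. -/
def gaussIter (α : ℝ) (n : ℕ) : ℝ := (fun x : ℝ => Int.fract x⁻¹)^[n] (Int.fract α)

/-- The `n`-th partial quotient `a_n` of the continued fraction expansion of `α`
(for `n ≥ 1`). -/
def cfA (α : ℝ) (n : ℕ) : ℕ := ⌊(gaussIter α (n - 1))⁻¹⌋₊

/-- The denominators `q_n` of the convergents of the continued fraction of `α`:
`q₀ = 1`, `q₁ = a₁`, `q_{n+1} = a_{n+1} q_n + q_{n-1}`. -/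
def cfQ (α : ℝ) : ℕ → ℕ
  | 0 => 1
  | 1 => cfA α 1
  | n + 2 => cfA α (n + 2) * cfQ α (n + 1) + cfQ α n

/-- Birkhoff sums over the rotation by `α`: `S_n(φ)(x) = ∑_{i<n} φ(x + iα)`. -/
def birkhoffRot (α : ℝ) (φ : ℝ → ℝ) (n : ℕ) (x : ℝ) : ℝ :=
  ∑ i ∈ Finset.range n, φ (x + i * α)

/-- Distance to the nearest integer, `‖x‖ = min(x mod 1, 1 - x mod 1)`. -/
def distNearestInt (x : ℝ) : ℝ := min (Int.fract x) (1 - Int.fract x)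

/-- `h(x) = -log x - log(1-x)`, read on the circle. -/
def symLog (x : ℝ) : ℝ := -Real.log (Int.fract x) - Real.log (1 - Int.fract x)

/-- The points `{-iα (mod 1)}_{0 ≤ i < q}` defining the partition of `𝕋 = [0,1)`. -/
def partPoints (α : ℝ) (q : ℕ) : Set ℝ :=
  (fun i : ℕ => Int.fract (-(i : ℝ) * α)) '' Set.Iio q

/-- `(v, w)` is one of the intervals of the partition of `𝕋 = [0,1)` by the points
`{-iα}_{0 ≤ i < q}`: `v` is a partition point, `w` is the next partition point
(or the endpoint `1`), and no partition point lies strictly between them. -/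
def IsPartitionInterval (α : ℝ) (q : ℕ) (v w : ℝ) : Prop :=
  v ∈ partPoints α q ∧ (w ∈ partPoints α q ∨ w = 1) ∧ v < w ∧
    ∀ p ∈ partPoints α q, ¬(v < p ∧ p < w)

theorem gaussIter_succ (α : ℝ) (n : ℕ) :
    gaussIter α (n + 1) = Int.fract (gaussIter α n)⁻¹ := by
  simp only [gaussIter, Function.iterate_succ_apply']

theorem irrational_gaussIter {α : ℝ} (h : Irrational α) (n : ℕ) :
    Irrational (gaussIter α n) := by
  have fract_irr : ∀ {x : ℝ}, Irrational x → Irrational (Int.fract x) := by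
    intro x hx
    rw [Int.fract]
    exact hx.sub_intCast _
  induction n with
  | zero => exact fract_irr h
  | succ n ih =>
    rw [gaussIter_succ]
    exact fract_irr ih.inv

theorem gaussIter_mem_Ioo {α : ℝ} (h : Irrational α) (n : ℕ) :
    gaussIter α n ∈ Set.Ioo (0 : ℝ) 1 := by
  have hlt : gaussIter α n < 1 ∧ 0 ≤ gaussIter α n := by
    cases n with
    | zero => exact ⟨Int.fract_lt_one _, Int.fract_nonneg _⟩
    | succ n =>
      rw [gaussIter_succ]
      exact ⟨Int.fract_lt_one _, Int.fract_nonneg _⟩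
  exact ⟨lt_of_le_of_ne hlt.2 (irrational_gaussIter h n).ne_zero.symm, hlt.1⟩

theorem gaussIter_inv {α : ℝ} (h : Irrational α) (n : ℕ) :
    (gaussIter α n)⁻¹ = cfA α (n + 1) + gaussIter α (n + 1) := by
  have h0 := inv_nonneg.2 (gaussIter_mem_Ioo h n).1.le
  rw [gaussIter_succ, cfA, Nat.add_sub_cancel, natCast_floor_eq_intCast_floor h0]
  exact (Int.floor_add_fract _).symm

theorem one_le_cfA {α : ℝ} (h : Irrational α) (n : ℕ) : 1 ≤ cfA α (n + 1) := by
  have hx := gaussIter_mem_Ioo h n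
  rw [cfA, Nat.add_sub_cancel, Nat.one_le_floor_iff]
  exact (one_lt_inv₀ hx.1).2 hx.2 |>.le

theorem cfQ_pos {α : ℝ} (h : Irrational α) (n : ℕ) : 0 < cfQ α n := by
  induction n using Nat.twoStepInduction with
  | zero => simp [cfQ]
  | one => exact one_le_cfA h 0
  | more n h1 h2 => rw [cfQ]; omega

/-- Two consecutive convergents: the error recursion and the determinant identity. -/
theorem exists_convergents {α : ℝ} (h : Irrational α) (hα : α ∈ Set.Ioo (0 : ℝ) 1) (n : ℕ) :
    ∃ P P' : ℤ, (cfQ α (n + 1) * α - P' = -gaussIter α (n + 1) * (cfQ α n * α - P)) ∧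
      |P' * (cfQ α n : ℤ) - P * (cfQ α (n + 1) : ℤ)| = 1 := by
  induction n with
  | zero =>
    refine ⟨0, 1, ?_, by simp [cfQ]⟩
    have h0 : gaussIter α 0 = α := Int.fract_eq_self.2 ⟨hα.1.le, hα.2⟩
    have h1 := gaussIter_inv h 0
    rw [h0] at h1
    have h2 : α * α⁻¹ = 1 := mul_inv_cancel₀ hα.1.ne'
    rw [h1] at h2
    simp only [cfQ, zero_add] at h2 ⊢
    push_cast
    linarith
  | succ n ih =>
    obtain ⟨P, P', h1, h2⟩ := ih
    refine ⟨P', cfA α (n + 2) * P' + P, ?_, ?_⟩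
    · have h3 := gaussIter_inv h (n + 1)
      have hx := gaussIter_mem_Ioo h (n + 1)
      have h4 : gaussIter α (n + 1) * (gaussIter α (n + 1))⁻¹ = 1 := mul_inv_cancel₀ hx.1.ne'
      rw [h3] at h4
      simp only [cfQ]
      push_cast
      linear_combination (-(cfA α (n + 2) + gaussIter α (n + 1 + 1)) : ℝ) * (-h1)
        - (cfQ α n * α - P) * h4
    · rw [← h2, ← abs_neg]
      congr 1
      simp only [cfQ]
      push_cast
      ring

/-- The `n`-th convergent approximates `α` within `1 / (a_{n+1} q_n²)`. -/
theorem exists_isCoprime_abs_sub_le {α : ℝ} (h : Irrational α) (hα : α ∈ Set.Ioo (0 : ℝ) 1)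
    {n : ℕ} (hn : 1 ≤ n) :
    ∃ P : ℤ, IsCoprime P (cfQ α n : ℤ) ∧
      |cfQ α n * α - P| * (cfA α (n + 1) * cfQ α n) ≤ 1 := by
  obtain ⟨n, rfl⟩ : ∃ m, n = m + 1 := ⟨n - 1, by omega⟩
  obtain ⟨P, P', h1, h2⟩ := exists_convergents h hα n
  refine ⟨P', ?_, ?_⟩
  · rcases (abs_eq zero_le_one).1 h2 with h3 | h3
    · exact ⟨cfQ α n, -P, by linarith⟩
    · exact ⟨-cfQ α n, P, by linarith⟩
  · have hx := gaussIter_mem_Ioo h (n + 1)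
    have hx' := gaussIter_mem_Ioo h (n + 2)
    have h3 := gaussIter_inv h (n + 1)
    have h4 : gaussIter α (n + 1) * (gaussIter α (n + 1))⁻¹ = 1 := mul_inv_cancel₀ hx.1.ne'
    rw [h3] at h4
    have h5 : |(cfQ α n * α - P)| * (cfQ α (n + 1) + gaussIter α (n + 1) * cfQ α n) = 1 := by
      have hp : (0 : ℝ) ≤ cfQ α (n + 1) + gaussIter α (n + 1) * cfQ α n := by
        have := hx.1
        positivity
      rw [← abs_of_nonneg hp, ← abs_mul]
      have h6 : ((|P' * (cfQ α n : ℤ) - P * (cfQ α (n + 1) : ℤ)| : ℤ) : ℝ) = 1 := by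
        rw [h2]; norm_num
      push_cast at h6
      rw [← h6]
      congr 1
      linear_combination (cfQ α n : ℝ) * h1
    rw [h1, abs_mul, abs_neg, abs_of_pos hx.1]
    have hD : |(cfQ α n * α - P)| * cfQ α (n + 1) ≤ 1 := by
      have : 0 ≤ |(cfQ α n * α - P)| * (gaussIter α (n + 1) * cfQ α n) := by
        have := hx.1
        positivity
      linarith
    have ha : gaussIter α (n + 1) * cfA α (n + 1 + 1) ≤ 1 := by
      have := mul_pos hx.1 hx'.1
      linarith
    have h0 := hx.1
    calc gaussIter α (n + 1) * |(cfQ α n * α - P)| * (cfA α (n + 1 + 1) * cfQ α (n + 1))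
        = (gaussIter α (n + 1) * cfA α (n + 1 + 1)) *
          (|(cfQ α n * α - P)| * cfQ α (n + 1)) := by ring
      _ ≤ 1 * 1 := by gcongr
      _ = 1 := by norm_num

theorem log_sub_log_le_div {X Y m M : ℝ} (hX : 0 < X) (hm : 0 < m) (hY : m ≤ Y)
    (hM : 0 ≤ M) (hXY : X - Y ≤ M) : Real.log X - Real.log Y ≤ M / m := by
  have hY0 : 0 < Y := hm.trans_le hY
  rw [← Real.log_div hX.ne' hY0.ne']
  calc Real.log (X / Y) ≤ X / Y - 1 := Real.log_le_sub_one_of_pos (by positivity)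
    _ = (X - Y) / Y := by field_simp
    _ ≤ M / Y := by gcongr
    _ ≤ M / m := by gcongr

theorem log_pair_sub_le {q J A B l t u : ℝ} (hq : 0 < q) (hJ : 1 ≤ J)
    (hA : |q * A - J| ≤ 1 / 50) (hB : |q * B - J| ≤ 1 / 50) (hl : q * l ≤ 51 / 50)
    (ht : 0 < t) (htl : t < l) (hu : 0 < u) (hul : u < l) :
    (Real.log (A + t) + Real.log (B + (l - t))) - (Real.log (A + u) + Real.log (B + (l - u)))
      ≤ 4 * (1 / J ^ 2) := by
  rw [abs_le] at hA hB
  have hA0 : 0 < A := by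
    by_contra! hc
    nlinarith
  have hB0 : 0 < B := by
    by_contra! hc
    nlinarith
  have e : ∀ t, 0 < t → t < l → Real.log ((q * A + q * t) * (q * B + (q * l - q * t)))
      = 2 * Real.log q + (Real.log (A + t) + Real.log (B + (l - t))) := by
    intro t ht htl
    have h1 : A + t ≠ 0 := by positivity
    have h2 : B + (l - t) ≠ 0 := by
      have : 0 < l - t := by linarith
      positivity
    rw [show (q * A + q * t) * (q * B + (q * l - q * t))
      = (q * (A + t)) * (q * (B + (l - t))) by ring, Real.log_mul (by positivity) (by positivity),
      Real.log_mul hq.ne' h1, Real.log_mul hq.ne' h2]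
    ring
  have key : Real.log ((q * A + q * t) * (q * B + (q * l - q * t)))
      - Real.log ((q * A + q * u) * (q * B + (q * l - q * u))) ≤ 2 / (J ^ 2 / 2) := by
    have ht' : 0 < q * t := by positivity
    have hu' : 0 < q * u := by positivity
    have htl' : q * t < q * l := by gcongr
    have hul' : q * u < q * l := by gcongr
    generalize q * A = a at *
    generalize q * B = b at *
    generalize q * l = l at *
    generalize q * t = t at *
    generalize q * u = u at *
    apply log_sub_log_le_div
    · exact mul_pos (by linarith) (by linarith)
    · positivity
    · have h1 : J - 1 / 50 ≤ a + u := by linarith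
      have h2 : J - 1 / 50 ≤ b + (l - u) := by linarith
      have h3 : (J - 1 / 50) * (J - 1 / 50) ≤ (a + u) * (b + (l - u)) :=
        mul_le_mul h1 h2 (by linarith) (by linarith)
      nlinarith
    · norm_num
    · have h1 : (t - u) * (b - a) ≤ |t - u| * |b - a| := by
        rw [← abs_mul]; exact le_abs_self _
      have h2 : |t - u| ≤ 51 / 50 := abs_le.2 ⟨by linarith, by linarith⟩
      have h3 : |b - a| ≤ 1 / 25 := abs_le.2 ⟨by linarith, by linarith⟩
      have h4 : |t - u| * |b - a| ≤ 51 / 50 * (1 / 25) :=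
        mul_le_mul h2 h3 (abs_nonneg _) (by norm_num)
      nlinarith
  rw [e t ht htl, e u hu hul] at key
  have h4 : (2 : ℝ) / (J ^ 2 / 2) = 4 * (1 / J ^ 2) := by
    field_simp
    norm_num
  linarith

/-- A constant bounding the oscillation of the regular part of the Birkhoff sums. -/
def oscConst : ℝ := 4 * ∑' j : ℕ, 1 / ((j : ℝ) + 1) ^ 2

theorem sum_log_pair_sub_le {p : ℤ → ℝ} {q : ℕ} (hq : 0 < q)
    (hp : ∀ m, |q * p m - m| ≤ 1 / 100) (s : ℤ) {x y : ℝ}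
    (hx : x ∈ Set.Ioo (p s) (p (s + 1))) (hy : y ∈ Set.Ioo (p s) (p (s + 1))) (N : ℕ) :
    |∑ j ∈ Finset.range N, (Real.log (x - p (s - (j + 1))) + Real.log (p (s + 1 + (j + 1)) - x)) -
      ∑ j ∈ Finset.range N, (Real.log (y - p (s - (j + 1))) + Real.log (p (s + 1 + (j + 1)) - y))|
      ≤ oscConst := by
  have hq' : (0 : ℝ) < q := by exact_mod_cast hq
  have main : ∀ x ∈ Set.Ioo (p s) (p (s + 1)), ∀ y ∈ Set.Ioo (p s) (p (s + 1)),
      ∑ j ∈ Finset.range N,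
        (Real.log (x - p (s - (j + 1))) + Real.log (p (s + 1 + (j + 1)) - x)) -
      ∑ j ∈ Finset.range N,
        (Real.log (y - p (s - (j + 1))) + Real.log (p (s + 1 + (j + 1)) - y)) ≤ oscConst := by
    rintro x ⟨hx1, hx2⟩ y ⟨hy1, hy2⟩
    rw [← Finset.sum_sub_distrib]
    have hsum : Summable fun j : ℕ => 1 / ((j : ℝ) + 1) ^ 2 := by
      have := (summable_nat_add_iff 1).2 (Real.summable_one_div_nat_pow.2 (one_lt_two))
      simpa using this
    calc _ ≤ ∑ j ∈ Finset.range N, 4 * (1 / ((j : ℝ) + 1) ^ 2) := by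
          apply Finset.sum_le_sum
          intro j _
          have h1 := abs_le.1 (hp s)
          have h2 := abs_le.1 (hp (s + 1))
          have h3 := abs_le.1 (hp (s - (j + 1)))
          have h4 := abs_le.1 (hp (s + 1 + (j + 1)))
          push_cast at h1 h2 h3 h4
          have := log_pair_sub_le (q := q) (J := j + 1) (A := p s - p (s - (j + 1)))
            (B := p (s + 1 + (j + 1)) - p (s + 1)) (l := p (s + 1) - p s)
            (t := x - p s) (u := y - p s) hq' (by linarith [(Nat.cast_nonneg j : (0 : ℝ) ≤ j)])
            (abs_le.2 ⟨by linarith, by linarith⟩) (abs_le.2 ⟨by linarith, by linarith⟩)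
            (by linarith) (by linarith) (by linarith) (by linarith) (by linarith)
          convert this using 3 <;> congr 1 <;> ring
      _ ≤ oscConst := by
          rw [← Finset.mul_sum, oscConst]
          gcongr
          exact hsum.sum_le_tsum _ (fun _ _ => by positivity)
  exact abs_le.2 ⟨by linarith [main y hy x hx], main x hx y hy⟩

/-- The index `i ∈ [0, q)` of the partition point `-iα` lying next to `m / q`, where
`r` is an inverse of `-P` modulo `q`. -/
def latticeIndex (r : ℤ) (q : ℕ) (m : ℤ) : ℕ := ((m * r) % (q : ℤ)).toNat

/-- The lift to `ℝ` of the partition point lying next to `m / q`. -/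
def latticePoint (α : ℝ) (P r : ℤ) (q : ℕ) (m : ℤ) : ℝ :=
  m / q - latticeIndex r q m * (α - P / q)

section Lattice

variable {α : ℝ} {P r : ℤ} {q : ℕ}

theorem latticeIndex_cast (hq : 0 < q) (m : ℤ) : (latticeIndex r q m : ℤ) = (m * r) % (q : ℤ) :=
  Int.toNat_of_nonneg (Int.emod_nonneg _ (by omega))

theorem latticeIndex_lt (hq : 0 < q) (m : ℤ) : latticeIndex r q m < q := by
  have h1 := latticeIndex_cast (r := r) hq m
  have h2 := Int.emod_lt_of_pos (m * r) (by omega : (0 : ℤ) < q)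
  omega

theorem latticePoint_eq (hq : 0 < q) (hr : (q : ℤ) ∣ r * P + 1) (m : ℤ) :
    ∃ z : ℤ, latticePoint α P r q m = -(latticeIndex r q m : ℝ) * α + z := by
  have h1 := latticeIndex_cast (r := r) hq m
  have h2 : (q : ℤ) ∣ m + latticeIndex r q m * P := by
    rw [h1, Int.emod_def]
    obtain ⟨c, hc⟩ := hr
    exact ⟨m * c - (m * r / q) * P, by linear_combination m * hc⟩
  obtain ⟨z, hz⟩ := h2
  refine ⟨z, ?_⟩
  have hz' : (m : ℝ) + latticeIndex r q m * P = q * z := by exact_mod_cast hz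
  have hq' : (q : ℝ) ≠ 0 := by positivity
  rw [latticePoint]
  field_simp
  linear_combination hz'

theorem latticePoint_add_mul (hq : 0 < q) (m z : ℤ) :
    latticePoint α P r q (m + q * z) = latticePoint α P r q m + z := by
  have hq' : (q : ℝ) ≠ 0 := by positivity
  have h : latticeIndex r q (m + q * z) = latticeIndex r q m := by
    rw [latticeIndex, latticeIndex, show (m + q * z) * r = m * r + q * (z * r) by ring,
      Int.add_mul_emod_self_left]
  rw [latticePoint, latticePoint, h]
  push_cast
  field_simp
  ring

theorem abs_latticePoint_sub_le (hq : 0 < q) (hP : |q * α - P| * (100 * q) ≤ 1) (m : ℤ) :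
    |q * latticePoint α P r q m - m| ≤ 1 / 100 := by
  have hq' : (0 : ℝ) < q := by positivity
  have h1 : q * latticePoint α P r q m - m = -(latticeIndex r q m * (q * α - P)) := by
    rw [latticePoint]
    field_simp
    ring
  have h2 : (latticeIndex r q m : ℝ) ≤ q := by exact_mod_cast (latticeIndex_lt hq m).le
  rw [h1, abs_neg, abs_mul, abs_of_nonneg (Nat.cast_nonneg _)]
  have := mul_le_mul_of_nonneg_right h2 (abs_nonneg (q * α - P))
  linarith

theorem exists_latticePoint_eq (hq : 0 < q) (hr : (q : ℤ) ∣ r * P + 1) {i : ℕ} (hi : i < q)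
    (z : ℤ) : ∃ m, latticePoint α P r q m = -(i : ℝ) * α + z := by
  have h1 : latticeIndex r q (-(i * P)) = i := by
    have h2 : ((-(i * P) * r) % (q : ℤ)) = i := by
      obtain ⟨c, hc⟩ := hr
      rw [show -((i : ℤ) * P) * r = i + q * (-(i * c)) by linear_combination (-(i : ℤ)) * hc,
        Int.add_mul_emod_self_left]
      exact Int.emod_eq_of_lt (by omega) (by omega)
    rw [latticeIndex, h2, Int.toNat_natCast]
  obtain ⟨z', hz'⟩ := latticePoint_eq (α := α) hq hr (-(i * P))
  refine ⟨-(i * P) + q * (z - z'), ?_⟩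
  rw [latticePoint_add_mul hq, hz', h1]
  push_cast
  ring

theorem sum_latticeIndex (hq : 0 < q) (hr : (q : ℤ) ∣ r * P + 1) (s e : ℤ) (he : e = 1 ∨ e = -1)
    (g : ℕ → ℝ) :
    ∑ i ∈ Finset.range q, g i = ∑ j ∈ Finset.range q, g (latticeIndex r q (s + e * j)) := by
  have hmaps : Set.MapsTo (fun j : ℕ => latticeIndex r q (s + e * j)) (Finset.range q : Set ℕ)
      (Finset.range q) := by
    intro j _
    simpa using latticeIndex_lt hq _
  have hinj : Set.InjOn (fun j : ℕ => latticeIndex r q (s + e * j)) (Finset.range q : Set ℕ) := by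
    intro j hj j' hj' h
    simp only [Finset.coe_range, Set.mem_Iio] at hj hj'
    have h1 : ((s + e * j) * r) % (q : ℤ) = ((s + e * j') * r) % (q : ℤ) := by
      rw [← latticeIndex_cast hq, ← latticeIndex_cast hq]
      exact_mod_cast h
    have h2 := Int.ModEq.dvd h1
    obtain ⟨c, hc⟩ := hr
    obtain ⟨d, hd⟩ := h2
    have h3 : (q : ℤ) ∣ (j - j' : ℤ) := by
      rcases he with rfl | rfl
      · exact ⟨c * (j - j') + d * P, by linear_combination (-(j' : ℤ) + j) * hc + P * hd⟩
      · exact ⟨c * (j - j') - d * P, by linear_combination (-(j' : ℤ) + j) * hc - P * hd⟩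
    have h4 := Int.eq_zero_of_abs_lt_dvd h3 (abs_lt.2 ⟨by omega, by omega⟩)
    omega
  symm
  refine Finset.sum_nbij _ (fun j hj => ?_) hinj ?_ (fun _ _ => rfl)
  · exact hmaps hj
  · exact Finset.surjOn_of_injOn_of_card_le _ hmaps hinj le_rfl

theorem birkhoffRot_symLog_eq (hq : 0 < q) (hr : (q : ℤ) ∣ r * P + 1)
    (hmono : StrictMono (latticePoint α P r q)) (s : ℤ) {x : ℝ}
    (hx : x ∈ Set.Ioo (latticePoint α P r q s) (latticePoint α P r q (s + 1))) :
    birkhoffRot α symLog q x = -∑ j ∈ Finset.range q,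
      (Real.log (x - latticePoint α P r q (s - j)) +
        Real.log (latticePoint α P r q (s + 1 + j) - x)) := by
  have hfract : ∀ (m z : ℤ), 0 ≤ x - latticePoint α P r q m + z →
      x - latticePoint α P r q m + z < 1 →
      Int.fract (x + latticeIndex r q m * α) = x - latticePoint α P r q m + z := by
    intro m z h0 h1
    obtain ⟨z', hz'⟩ := latticePoint_eq (α := α) hq hr m
    rw [Int.fract_eq_iff]
    refine ⟨h0, h1, z' - z, ?_⟩
    rw [hz']
    push_cast
    ring
  have hper := fun m => latticePoint_add_mul (α := α) (P := P) (r := r) hq m 1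
  simp only [mul_one, Int.cast_one] at hper
  have h1 : ∑ i ∈ Finset.range q, Real.log (Int.fract (x + i * α)) =
      ∑ j ∈ Finset.range q, Real.log (x - latticePoint α P r q (s - j)) := by
    rw [sum_latticeIndex hq hr s (-1) (Or.inr rfl)
      (fun i => Real.log (Int.fract (x + i * α)))]
    refine Finset.sum_congr rfl fun j hj => ?_
    rw [Finset.mem_range] at hj
    have e : s + -1 * (j : ℤ) = s - j := by ring
    have h2 := hmono.monotone (show s - (j : ℤ) ≤ s by omega)
    have h3 := hmono.monotone (show s + 1 ≤ s - (j : ℤ) + q by omega)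
    rw [hper] at h3
    rw [e, hfract (s - j) 0]
    · simp
    · push_cast; linarith [hx.1]
    · push_cast; linarith [hx.2]
  have h2 : ∑ i ∈ Finset.range q, Real.log (1 - Int.fract (x + i * α)) =
      ∑ j ∈ Finset.range q, Real.log (latticePoint α P r q (s + 1 + j) - x) := by
    rw [sum_latticeIndex hq hr (s + 1) 1 (Or.inl rfl)
      (fun i => Real.log (1 - Int.fract (x + i * α)))]
    refine Finset.sum_congr rfl fun j hj => ?_
    rw [Finset.mem_range] at hj
    have h2 := hmono.monotone (show s + 1 ≤ s + 1 + (j : ℤ) by omega)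
    have h3 := hmono.monotone (show s + 1 + (j : ℤ) ≤ s + q by omega)
    rw [hper] at h3
    rw [one_mul, hfract (s + 1 + j) 1]
    · congr 1; push_cast; ring
    · push_cast; linarith [hx.1]
    · push_cast; linarith [hx.2]
  simp only [birkhoffRot, symLog]
  rw [Finset.sum_sub_distrib, Finset.sum_neg_distrib, Finset.sum_add_distrib, h1, h2]
  ring

theorem IsPartitionInterval.exists_latticePoint (hq : 0 < q) (hr : (q : ℤ) ∣ r * P + 1)
    (hmono : StrictMono (latticePoint α P r q)) {v w : ℝ} (h : IsPartitionInterval α q v w) :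
    ∃ s : ℤ, v = latticePoint α P r q s ∧ w = latticePoint α P r q (s + 1) := by
  obtain ⟨hv, hw, hvw, hno⟩ := h
  have of_mem : ∀ x ∈ partPoints α q,
      (∃ m, latticePoint α P r q m = x) ∧ x ∈ Set.Ico (0 : ℝ) 1 := by
    rintro x ⟨i, hi, rfl⟩
    refine ⟨?_, Int.fract_nonneg _, Int.fract_lt_one _⟩
    obtain ⟨m, hm⟩ := exists_latticePoint_eq (α := α) hq hr hi (-⌊-(i : ℝ) * α⌋)
    refine ⟨m, ?_⟩
    rw [hm]
    simp only [Int.fract]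
    push_cast
    ring
  obtain ⟨⟨s, hs⟩, hv0, hv1⟩ := of_mem v hv
  have hw' : (∃ m, latticePoint α P r q m = w) ∧ w ≤ 1 := by
    rcases hw with hw | rfl
    · obtain ⟨h1, h2⟩ := of_mem w hw
      exact ⟨h1, h2.2.le⟩
    · obtain ⟨m, hm⟩ := exists_latticePoint_eq (α := α) hq hr hq 1
      exact ⟨⟨m, by simpa using hm⟩, le_rfl⟩
  obtain ⟨⟨s', hs'⟩, hw1⟩ := hw'
  have hlt : s < s' := hmono.lt_iff_lt.1 (by rw [hs, hs']; exact hvw)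
  refine ⟨s, hs.symm, ?_⟩
  rw [← hs']
  congr 1
  by_contra hne
  have h1 : v < latticePoint α P r q (s + 1) := hs ▸ hmono (by omega)
  have h2 : latticePoint α P r q (s + 1) < w := hs' ▸ hmono (by omega)
  refine hno _ ⟨latticeIndex r q (s + 1), latticeIndex_lt hq _, ?_⟩ ⟨h1, h2⟩
  obtain ⟨z, hz⟩ := latticePoint_eq (α := α) hq hr (s + 1)
  refine Int.fract_eq_iff.2 ⟨by linarith, by linarith, -z, ?_⟩
  rw [hz]
  push_cast
  ring

end Lattice

/-- On a partition interval, the Birkhoff sum of `h` equals the contribution of the two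
endpoints up to a bounded error. -/
theorem abs_birkhoffRot_symLog_sub_le {α : ℝ} {P : ℤ} {q : ℕ} (hq : 0 < q)
    (hPq : IsCoprime P (q : ℤ)) (hP : |q * α - P| * (100 * q) ≤ 1) {v w : ℝ}
    (h : IsPartitionInterval α q v w) :
    49 / 50 ≤ q * (w - v) ∧ q * (w - v) ≤ 51 / 50 ∧
    ∀ x ∈ Set.Ioo v w, ∀ y ∈ Set.Ioo v w,
      |(birkhoffRot α symLog q x - birkhoffRot α symLog q y) +
        ((Real.log (x - v) + Real.log (w - x)) - (Real.log (y - v) + Real.log (w - y)))|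
        ≤ oscConst := by
  obtain ⟨a, b, hab⟩ := hPq
  have hr : (q : ℤ) ∣ (-a) * P + 1 := ⟨b, by linear_combination (-1 : ℤ) * hab⟩
  have hclose := abs_latticePoint_sub_le (r := -a) hq hP
  have hq' : (0 : ℝ) < q := by positivity
  have hmono : StrictMono (latticePoint α P (-a) q) := by
    intro m m' hm
    have h1 := abs_le.1 (hclose m)
    have h2 := abs_le.1 (hclose m')
    have h3 : (m : ℝ) + 1 ≤ m' := by exact_mod_cast hm
    refine lt_of_mul_lt_mul_left ?_ hq'.le
    linarith
  obtain ⟨s, rfl, rfl⟩ := h.exists_latticePoint hq hr hmono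
  have h1 := abs_le.1 (hclose s)
  have h2 := abs_le.1 (hclose (s + 1))
  push_cast at h2
  refine ⟨by linarith, by linarith, fun x hx y hy => ?_⟩
  rw [birkhoffRot_symLog_eq hq hr hmono s hx, birkhoffRot_symLog_eq hq hr hmono s hy]
  obtain ⟨N, rfl⟩ : ∃ N, q = N + 1 := ⟨q - 1, by omega⟩
  rw [Finset.sum_range_succ', Finset.sum_range_succ' (n := N)]
  have h3 := sum_log_pair_sub_le hq hclose s hy hx N
  push_cast at h3 ⊢
  simp only [sub_zero, add_zero]
  convert h3 using 2
  ring

/-- Sublevel sets of `x ↦ -log ((x - v)(w - x))` up to a bounded error. -/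
theorem sublevel_near_endpoints {C q v w b : ℝ} (hC : 0 ≤ C) (hb : 0 < b) (hq : 0 < q)
    (h1 : 49 / 50 ≤ q * (w - v)) (h2 : q * (w - v) ≤ 51 / 50) {G : ℝ → ℝ}
    (hG : ∀ x ∈ Set.Ioo v w, |G x + ((Real.log (x - v) + Real.log (w - x)) -
      (Real.log ((v + w) / 2 - v) + Real.log (w - (v + w) / 2)))| ≤ C) :
    (Set.Ioo v (v + (3 * Real.exp C)⁻¹ * Real.exp (-b) / (2 * q))
        ∪ Set.Ioo (w - (3 * Real.exp C)⁻¹ * Real.exp (-b) / (2 * q)) w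
      ⊆ {x ∈ Set.Ioo v w | b ≤ |G x|}) ∧
    ({x ∈ Set.Ioo v w | b ≤ |G x|}
      ⊆ Set.Ioo v (v + 3 * Real.exp C * Real.exp (-b) / (2 * q))
        ∪ Set.Ioo (w - 3 * Real.exp C * Real.exp (-b) / (2 * q)) w) := by
  have hl : 0 < w - v := by
    by_contra! hc
    nlinarith
  have hG' : ∀ x ∈ Set.Ioo v w,
      |G x + Real.log (4 * ((q * (x - v)) * (q * (w - x))) / (q * (w - v)) ^ 2)| ≤ C := by
    intro x hx
    have hxv : 0 < x - v := by linarith [hx.1]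
    have hxw : 0 < w - x := by linarith [hx.2]
    convert hG x hx using 3
    rw [show (v + w) / 2 - v = (w - v) / 2 by ring, show w - (v + w) / 2 = (w - v) / 2 by ring,
      ← Real.log_mul hxv.ne' hxw.ne', ← Real.log_mul (by positivity) (by positivity),
      ← Real.log_div (by positivity) (by positivity)]
    congr 1
    field_simp
    norm_num
  have hexp : Real.exp C * Real.exp (-C) = 1 := by rw [← Real.exp_add]; simp
  have hinv : (3 * Real.exp C)⁻¹ * Real.exp (-b) / (2 * q) = Real.exp (-C - b) / (6 * q) := by
    rw [sub_eq_add_neg, Real.exp_add, Real.exp_neg C]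
    field_simp
    norm_num
  have hmul : 3 * Real.exp C * Real.exp (-b) / (2 * q) = 3 * Real.exp (C - b) / (2 * q) := by
    rw [sub_eq_add_neg, Real.exp_add]
    ring
  have hsmall : Real.exp (-C - b) ≤ 1 := Real.exp_le_one_iff.2 (by linarith)
  rw [hinv, hmul]
  have lower : ∀ x ∈ Set.Ioo v w,
      q * (x - v) < Real.exp (-C - b) / 6 ∨ q * (w - x) < Real.exp (-C - b) / 6 → b ≤ |G x| := by
    intro x hx hlt
    have hxv : 0 < q * (x - v) := mul_pos hq (by linarith [hx.1])
    have hxw : 0 < q * (w - x) := mul_pos hq (by linarith [hx.2])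
    have hr : 4 * ((q * (x - v)) * (q * (w - x))) / (q * (w - v)) ^ 2 ≤ Real.exp (-C - b) := by
      rw [div_le_iff₀ (by positivity)]
      have he := Real.exp_pos (-C - b)
      have hsum : q * (w - v) = q * (x - v) + q * (w - x) := by ring
      have h3 : (q * (x - v)) * (q * (w - x)) ≤ Real.exp (-C - b) / 6 * (q * (w - v)) := by
        rcases hlt with hlt | hlt
        · exact mul_le_mul hlt.le (by linarith) hxw.le (by positivity)
        · rw [mul_comm]
          exact mul_le_mul hlt.le (by linarith) hxv.le (by positivity)
      have h4 : 49 / 50 * (q * (w - v)) ≤ (q * (w - v)) ^ 2 := by nlinarith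
      nlinarith
    have h3 := Real.log_le_log (by positivity) hr
    rw [Real.log_exp] at h3
    have h4 := abs_le.1 (hG' x hx)
    have h5 := le_abs_self (G x)
    linarith
  have upper : ∀ x ∈ Set.Ioo v w, b ≤ |G x| →
      q * (x - v) < 3 * Real.exp (C - b) / 2 ∨ q * (w - x) < 3 * Real.exp (C - b) / 2 := by
    intro x hx hbG
    have hxv : 0 < q * (x - v) := mul_pos hq (by linarith [hx.1])
    have hxw : 0 < q * (w - x) := mul_pos hq (by linarith [hx.2])
    have hsum : q * (w - v) = q * (x - v) + q * (w - x) := by ring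
    have hR : 0 < 4 * ((q * (x - v)) * (q * (w - x))) / (q * (w - v)) ^ 2 := by positivity
    have hR1 : 4 * ((q * (x - v)) * (q * (w - x))) / (q * (w - v)) ^ 2 ≤ 1 := by
      rw [div_le_one (by positivity), hsum]
      nlinarith [sq_nonneg (q * (x - v) - q * (w - x))]
    have h3 := Real.log_nonpos hR.le hR1
    have h4 := abs_le.1 (hG' x hx)
    have h5 : Real.log (4 * ((q * (x - v)) * (q * (w - x))) / (q * (w - v)) ^ 2) ≤ C - b := by
      rcases abs_cases (G x) with h | h <;> linarith
    rw [Real.log_le_iff_le_exp hR, div_le_iff₀ (by positivity)] at h5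
    by_contra! hcon
    have he := Real.exp_pos (C - b)
    obtain ⟨hc1, hc2⟩ := hcon
    rw [hsum] at h5 h2
    generalize q * (x - v) = X at *
    generalize q * (w - x) = Y at *
    generalize Real.exp (C - b) = E at *
    have h6 : E * (X + Y) ^ 2 ≤ 51 / 50 * (E * (X + Y)) := by
      nlinarith [mul_pos he (add_pos hxv hxw)]
    rcases le_total X Y with hle | hle
    · nlinarith [mul_pos hxv hxw, mul_pos he hxw, mul_le_mul_of_nonneg_right hc1 hxw.le]
    · nlinarith [mul_pos hxv hxw, mul_pos he hxv, mul_le_mul_of_nonneg_right hc2 hxv.le]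
  have hscale : ∀ {e d t : ℝ}, t < e / (d * q) → q * t < e / d := by
    intro e d t ht
    have := mul_lt_mul_of_pos_left ht hq
    rwa [show q * (e / (d * q)) = e / d by rw [mul_comm d q]; field_simp] at this
  have hscale' : ∀ {e d t : ℝ}, q * t < e / d → t < e / (d * q) := by
    intro e d t ht
    rwa [← div_div, lt_div_iff₀ hq, mul_comm]
  constructor
  · rintro x (⟨hx1, hx2⟩ | ⟨hx1, hx2⟩)
    · have h3 := hscale (show x - v < Real.exp (-C - b) / (6 * q) by linarith)
      have hx : x ∈ Set.Ioo v w := ⟨hx1, lt_of_mul_lt_mul_left (by linarith) hq.le⟩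
      exact ⟨hx, lower x hx (Or.inl h3)⟩
    · have h3 := hscale (show w - x < Real.exp (-C - b) / (6 * q) by linarith)
      have hx : x ∈ Set.Ioo v w := ⟨lt_of_mul_lt_mul_left (by linarith) hq.le, hx2⟩
      exact ⟨hx, lower x hx (Or.inr h3)⟩
  · rintro x ⟨hx, hbG⟩
    rcases upper x hx hbG with h3 | h3
    · exact Or.inl ⟨hx.1, by linarith [hscale' h3]⟩
    · exact Or.inr ⟨by linarith [hscale' h3], hx.2⟩

/-- Claim A. For `α ∈ 𝒞_{K,L}` (`L > K`) with associated sequence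
`(n_k)` and `h(x) = -log x - log(1-x)`: there exist `D, b₀ > 0` and `k₀` such that for all
`k ≥ k₀`, `b ≥ b₀` and every partition interval `I_s = (v_s, w_s)` of `𝕋` by
`{-iα}_{i<q_{n_k}}`, with `y_s` the midpoint of `I_s`,
`(v_s, v_s + D⁻¹e^{-b}/(2q)) ∪ (w_s - D⁻¹e^{-b}/(2q), w_s) ⊆ W_{k,s}(b) ⊆`
`(v_s, v_s + De^{-b}/(2q)) ∪ (w_s - De^{-b}/(2q), w_s)` where
`W_{k,s}(b) = {x ∈ I_s : |S_{q_{n_k}}(h)(x) - S_{q_{n_k}}(h)(y_s)| ≥ b}`. -/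
theorem statement14 (K L : ℕ) (hKL : K < L)
    (α : ℝ) (hirr : Irrational α) (hα : α ∈ Set.Ioo (0 : ℝ) 1)
    (nk : ℕ → ℕ) (hnk : StrictMono nk) (c : ℝ) (hc : 0 < c)
    (hdio1 : ∀ k n : ℕ, 1 ≤ n → n ≤ nk k →
      (cfA α (nk k + 1 - n) : ℝ) ≤ Real.exp (c * n))
    (hdio2 : ∀ k : ℕ, 100 * (K ^ 2 + L ^ 2) < cfA α (nk k + 1) ∧
      cfA α (nk k + 1) < 200 * (K ^ 2 + L ^ 2)) :
    ∃ D > (0 : ℝ), ∃ k₀ : ℕ, ∃ b₀ > (0 : ℝ), ∀ k ≥ k₀, ∀ b ≥ b₀, ∀ v w : ℝ,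
      IsPartitionInterval α (cfQ α (nk k)) v w →
      (Set.Ioo v (v + D⁻¹ * Real.exp (-b) / (2 * (cfQ α (nk k) : ℝ)))
          ∪ Set.Ioo (w - D⁻¹ * Real.exp (-b) / (2 * (cfQ α (nk k) : ℝ))) w
        ⊆ {x ∈ Set.Ioo v w |
            b ≤ |birkhoffRot α symLog (cfQ α (nk k)) x
                  - birkhoffRot α symLog (cfQ α (nk k)) ((v + w) / 2)|}) ∧
      ({x ∈ Set.Ioo v w |
          b ≤ |birkhoffRot α symLog (cfQ α (nk k)) x
                - birkhoffRot α symLog (cfQ α (nk k)) ((v + w) / 2)|}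
        ⊆ Set.Ioo v (v + D * Real.exp (-b) / (2 * (cfQ α (nk k) : ℝ)))
            ∪ Set.Ioo (w - D * Real.exp (-b) / (2 * (cfQ α (nk k) : ℝ))) w) := by
  have hC : 0 ≤ oscConst := by
    have : 0 ≤ ∑' j : ℕ, 1 / ((j : ℝ) + 1) ^ 2 := tsum_nonneg fun _ => by positivity
    rw [oscConst]
    positivity
  refine ⟨3 * Real.exp oscConst, by positivity, 1, 1, one_pos, ?_⟩
  intro k hk b hb v w hI
  have hn : 1 ≤ nk k := hk.trans (hnk.id_le k)
  have hq := cfQ_pos hirr (nk k)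
  have hq' : (0 : ℝ) < cfQ α (nk k) := by exact_mod_cast hq
  obtain ⟨P, hPq, hP⟩ := exists_isCoprime_abs_sub_le hirr hα hn
  have ha : 100 ≤ cfA α (nk k + 1) := by
    have h1 := (hdio2 k).1
    have h2 : 1 ≤ K ^ 2 + L ^ 2 := by
      have : 1 ≤ L ^ 2 := Nat.one_le_pow _ _ (by omega)
      omega
    omega
  have ha' : (100 : ℝ) ≤ cfA α (nk k + 1) := by exact_mod_cast ha
  have hP' : |cfQ α (nk k) * α - P| * (100 * cfQ α (nk k)) ≤ 1 := by
    refine le_trans ?_ hP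
    gcongr
  obtain ⟨h1, h2, h3⟩ := abs_birkhoffRot_symLog_sub_le hq hPq hP' hI
  refine sublevel_near_endpoints hC (by linarith) hq' h1 h2 fun x hx => h3 x hx _ ?_
  exact ⟨by linarith [hI.2.2.1], by linarith [hI.2.2.1]⟩
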